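/- Let k ≤ n and let f be a Laurent polynomial in x_1,...,x_n over ℂ that is symmetric separately in its first k arguments and its last n−k arguments. Then f(x_1,...,x_n) = Σ_{I ∈ C(n,k)} (-1)^{ℓ(I)} V_I(x_1,...,x_k) · Σ_{J ∈ C(n,k)} f(x_J, x_{J̄}) · V_{Ī}(x_{J̄}) / R(x_J; x_{J̄}), as an identity of rational functions. -/

import Mathlib

noncomputable section

open MvPolynomial

/-- The field of rational functions `ℂ(x₁, …, x_n)`. -/
abbrev RF (n : ℕ) : Type := FractionRing (MvPolynomial (Fin n) ℂ)

/-- The variable `x_a` viewed inside `ℂ(x₁, …, x_n)`. -/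
def Xv (n : ℕ) (a : Fin n) : RF n :=
  algebraMap (MvPolynomial (Fin n) ℂ) (RF n) (X a)

/-- The increasing enumeration of an `m`-element subset of `{1, …, n}`. -/
def enum {n m : ℕ} (I : Finset (Fin n)) (hI : I.card = m) : Fin m → Fin n :=
  fun a => (I.orderIsoOfFin hI a : Fin n)

/-- `ℓ(I) = Σ_a (i_a − a)` for `I = {i₁ < … < i_m}` (`1`-indexed). -/
def ell {n m : ℕ} (I : Finset (Fin n)) (hI : I.card = m) : ℕ :=
  ∑ a : Fin m, ((((enum I hI a : Fin n) : ℕ) + 1) - (a.1 + 1))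

/-- The Schur-type rational function `V_I(t) = det(t_a^{i_b}) / det(t_a^b)`. -/
def V {F : Type*} [Field F] {n m : ℕ} (I : Finset (Fin n)) (hI : I.card = m)
    (t : Fin m → F) : F :=
  (Matrix.of fun a b : Fin m => t a ^ (((enum I hI b : Fin n) : ℕ) + 1)).det /
    (Matrix.of fun a b : Fin m => t a ^ (b.1 + 1)).det

/-- `R(x₁,…,x_k; y₁,…,y_{n−k}) = ∏_{a,b} (y_b − x_a)`. -/
def Rfun {F : Type*} [Field F] {k m : ℕ} (x : Fin k → F) (y : Fin m → F) : F :=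
  ∏ a : Fin k, ∏ b : Fin m, (y b - x a)

/-- The permutation of `{1, …, n}` which lists the elements of the `k`-element
subset `J` in increasing order, followed by the elements of its complement in
increasing order (the minimal-length permutation with `{σ(1),…,σ(k)} = J`). -/
def permOfSubset {n k : ℕ} (hk : k ≤ n) (J : Finset (Fin n)) (hJ : J.card = k) :
    Equiv.Perm (Fin n) :=
  (finCongr (Nat.add_sub_cancel' hk)).symm.trans <|
    finSumFinEquiv.symm.trans <|
      (Equiv.sumCongr (J.orderIsoOfFin hJ).toEquiv
          ((Jᶜ.orderIsoOfFin (by simp [Finset.card_compl, hJ])).toEquiv.trans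
            (Equiv.subtypeEquivRight fun x => Finset.mem_compl))).trans
        (Equiv.sumCompl (· ∈ J))

/-- The identification of `{1, …, n}` with its first `k` elements followed by its last `n - k`. -/
def blockEquiv {n k : ℕ} (hk : k ≤ n) : Fin k ⊕ Fin (n - k) ≃ Fin n :=
  finSumFinEquiv.trans (finCongr (Nat.add_sub_cancel' hk))

lemma blockEquiv_inl {n k : ℕ} (hk : k ≤ n) (a : Fin k) :
    blockEquiv hk (.inl a) = ⟨a.1, lt_of_lt_of_le a.2 hk⟩ := rfl

lemma val_blockEquiv_inl {n k : ℕ} (hk : k ≤ n) (a : Fin k) :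
    (blockEquiv hk (.inl a)).1 = a.1 := rfl

lemma val_blockEquiv_inr {n k : ℕ} (hk : k ≤ n) (b : Fin (n - k)) :
    (blockEquiv hk (.inr b)).1 = k + b.1 := rfl

lemma card_compl_of_card_eq {n k : ℕ} {I : Finset (Fin n)} (hI : I.card = k) :
    Iᶜ.card = n - k := by
  simp [Finset.card_compl, hI]

lemma permOfSubset_blockEquiv_inl {n k : ℕ} (hk : k ≤ n) (J : Finset (Fin n)) (hJ : J.card = k)
    (a : Fin k) : permOfSubset hk J hJ (blockEquiv hk (.inl a)) = enum J hJ a := by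
  simp [permOfSubset, blockEquiv, enum]

lemma permOfSubset_blockEquiv_inr {n k : ℕ} (hk : k ≤ n) (J : Finset (Fin n)) (hJ : J.card = k)
    (b : Fin (n - k)) : permOfSubset hk J hJ (blockEquiv hk (.inr b)) =
      enum Jᶜ (card_compl_of_card_eq hJ) b := by
  simp [permOfSubset, blockEquiv, enum]

lemma enum_strictMono {n m : ℕ} (I : Finset (Fin n)) (hI : I.card = m) :
    StrictMono (enum I hI) :=
  fun _ _ h => (I.orderIsoOfFin hI).strictMono h

lemma enum_mem {n m : ℕ} (I : Finset (Fin n)) (hI : I.card = m) (a : Fin m) :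
    enum I hI a ∈ I :=
  (I.orderIsoOfFin hI a).2

lemma exists_enum_eq {n m : ℕ} {I : Finset (Fin n)} (hI : I.card = m) {i : Fin n} (hi : i ∈ I) :
    ∃ a, enum I hI a = i :=
  ⟨(I.orderIsoOfFin hI).symm ⟨i, hi⟩, by simp [enum]⟩

/-- A product over pairs `i < j` splits according to the block decomposition. -/
lemma prod_prod_Ioi_blockEquiv {M : Type*} [CommMonoid M] {n k : ℕ} (hk : k ≤ n)
    (f : Fin n → Fin n → M) :
    ∏ i, ∏ j ∈ Finset.Ioi i, f i j =
      (∏ a : Fin k, ∏ b ∈ Finset.Ioi a, f (blockEquiv hk (.inl a)) (blockEquiv hk (.inl b))) *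
      (∏ a : Fin (n - k), ∏ b ∈ Finset.Ioi a,
        f (blockEquiv hk (.inr a)) (blockEquiv hk (.inr b))) *
      ∏ a : Fin k, ∏ b : Fin (n - k), f (blockEquiv hk (.inl a)) (blockEquiv hk (.inr b)) := by
  have hIoi (m : ℕ) (i : Fin m) (g : Fin m → M) :
      ∏ j ∈ Finset.Ioi i, g j = ∏ j, if i.1 < j.1 then g j else 1 := by
    rw [← Finset.prod_filter]
    exact Finset.prod_congr (by ext; simp) fun _ _ => rfl
  simp_rw [hIoi]
  rw [← (blockEquiv hk).prod_comp]
  have hsplit (i : Fin n) : (∏ j : Fin n, if i.1 < j.1 then f i j else 1) =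
      (∏ b : Fin k, if i.1 < b.1 then f i (blockEquiv hk (.inl b)) else 1) *
        ∏ b : Fin (n - k), if i.1 < k + b.1 then f i (blockEquiv hk (.inr b)) else 1 := by
    rw [← (blockEquiv hk).prod_comp, Fintype.prod_sum_type]
    rfl
  simp only [hsplit, Fintype.prod_sum_type, val_blockEquiv_inl, val_blockEquiv_inr,
    Finset.prod_mul_distrib]
  have h1 (a : Fin k) (b : Fin (n - k)) : a.1 < k + b.1 := by omega
  have h2 (a : Fin (n - k)) (b : Fin k) : ¬ k + a.1 < b.1 := by omega
  simp [h1, h2, mul_right_comm, mul_assoc]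

lemma card_enum_compl_lt {n k : ℕ} (hk : k ≤ n) (I : Finset (Fin n)) (hI : I.card = k)
    (a : Fin k) :
    (Finset.univ.filter fun b => enum Iᶜ (card_compl_of_card_eq hI) b < enum I hI a).card =
      (enum I hI a).1 + 1 - (a.1 + 1) := by
  have hcount : (∑ j : Fin n, if j < enum I hI a then 1 else 0) = (enum I hI a).1 := by
    rw [← Finset.card_filter, ← Fin.card_Iio]
    congr 1
    ext; simp
  rw [← ((blockEquiv hk).trans (permOfSubset hk I hI)).sum_comp, Fintype.sum_sum_type] at hcount
  simp only [Equiv.trans_apply, permOfSubset_blockEquiv_inl, permOfSubset_blockEquiv_inr,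
    (enum_strictMono I hI).lt_iff_lt, ← Finset.card_filter] at hcount
  have : (Finset.univ.filter fun b : Fin k => b < a).card = a.1 := by
    rw [← Fin.card_Iio]
    congr 1
    ext; simp
  omega

lemma sign_permOfSubset {n k : ℕ} (hk : k ≤ n) (I : Finset (Fin n)) (hI : I.card = k) :
    Equiv.Perm.sign (permOfSubset hk I hI) = (-1) ^ ell I hI := by
  rw [Equiv.Perm.sign_eq_prod_prod_Ioi, prod_prod_Ioi_blockEquiv hk]
  simp only [permOfSubset_blockEquiv_inl, permOfSubset_blockEquiv_inr,
    (enum_strictMono _ _).lt_iff_lt]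
  rw [Finset.prod_eq_one, Finset.prod_eq_one, one_mul, one_mul, ell, ← Finset.prod_pow_eq_pow_sum]
  · refine Finset.prod_congr rfl fun a _ => ?_
    rw [← card_enum_compl_lt hk I hI a, ← Finset.prod_const, Finset.prod_filter]
    refine Finset.prod_congr rfl fun b _ => ?_
    have hne : enum I hI a ≠ enum Iᶜ (card_compl_of_card_eq hI) b := fun h =>
      Finset.mem_compl.1 (enum_mem Iᶜ (card_compl_of_card_eq hI) b) (h ▸ enum_mem I hI a)
    rcases lt_or_gt_of_ne hne with h | h
    · simp [h, h.not_gt]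
    · simp [h, h.not_gt]
  · exact fun a _ => Finset.prod_eq_one fun b hb => if_pos (Finset.mem_Ioi.1 hb)
  · exact fun a _ => Finset.prod_eq_one fun b hb => if_pos (Finset.mem_Ioi.1 hb)

/-- The determinant of the matrix obtained from `M` by keeping only the entries in the first `k`
rows with column in `I`, and in the last `n - k` rows with column outside `I`. -/
lemma det_mask_eq {R : Type*} [CommRing R] {n k : ℕ} (hk : k ≤ n) (M : Matrix (Fin n) (Fin n) R)
    (I : Finset (Fin n)) (hI : I.card = k) :
    (Matrix.of fun i j : Fin n => if i.1 < k ↔ j ∈ I then M i j else 0).det =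
      (-1) ^ ell I hI *
        (Matrix.of fun a b : Fin k => M (blockEquiv hk (.inl a)) (enum I hI b)).det *
        (Matrix.of fun a b : Fin (n - k) => M (blockEquiv hk (.inr a))
          (enum Iᶜ (card_compl_of_card_eq hI) b)).det := by
  set N : Matrix (Fin n) (Fin n) R :=
    Matrix.of fun i j : Fin n => if i.1 < k ↔ j ∈ I then M i j else 0 with hN
  have hperm := Matrix.det_permute' (permOfSubset hk I hI) N
  have hblocks : (N.submatrix id (permOfSubset hk I hI)).submatrix (blockEquiv hk) (blockEquiv hk)
      = Matrix.fromBlocks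
        (Matrix.of fun a b : Fin k => M (blockEquiv hk (.inl a)) (enum I hI b)) 0 0
        (Matrix.of fun a b : Fin (n - k) => M (blockEquiv hk (.inr a))
          (enum Iᶜ (card_compl_of_card_eq hI) b)) := by
    have hmem := enum_mem I hI
    have hnot := fun b => Finset.mem_compl.1 (enum_mem Iᶜ (card_compl_of_card_eq hI) b)
    ext (a | a) (b | b) <;>
      simp [hN, permOfSubset_blockEquiv_inl, permOfSubset_blockEquiv_inr, val_blockEquiv_inl,
        val_blockEquiv_inr, hmem, hnot]
  rw [← Matrix.det_submatrix_equiv_self (blockEquiv hk), hblocks, Matrix.det_fromBlocks_zero₂₁,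
    sign_permOfSubset] at hperm
  rw [mul_assoc, hperm, ← mul_assoc]
  simp [← mul_pow]

/-- Laplace expansion of a determinant along its first `k` rows. -/
lemma det_eq_sum_minors {R : Type*} [CommRing R] {n k : ℕ} (hk : k ≤ n)
    (M : Matrix (Fin n) (Fin n) R) :
    M.det = ∑ I : {s : Finset (Fin n) // s.card = k},
      (-1) ^ ell I.1 I.2 *
        (Matrix.of fun a b : Fin k => M (blockEquiv hk (.inl a)) (enum I.1 I.2 b)).det *
        (Matrix.of fun a b : Fin (n - k) => M (blockEquiv hk (.inr a))
          (enum I.1ᶜ (card_compl_of_card_eq I.2) b)).det := by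
  simp_rw [← det_mask_eq, ← Matrix.det_transpose (Matrix.of _)]
  rw [← Matrix.det_transpose]
  simp_rw [Matrix.det_apply', Matrix.transpose_apply, Matrix.of_apply]
  rw [Finset.sum_comm]
  refine Finset.sum_congr rfl fun σ _ => ?_
  rw [← Finset.mul_sum]
  congr 1
  have hcard : ((Finset.univ.filter fun i : Fin n => i.1 < k).map σ.toEmbedding).card = k := by
    rw [Finset.card_map, Fin.card_filter_val_lt, min_eq_right hk]
  rw [Finset.sum_eq_single ⟨_, hcard⟩]
  · refine Finset.prod_congr rfl fun i _ => ?_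
    simp
  · rintro ⟨I, hI⟩ - hne
    obtain ⟨i, hi⟩ : ∃ i : Fin n, ¬ (i.1 < k ↔ σ i ∈ I) := by
      by_contra! h
      refine hne (Subtype.ext ?_)
      ext j
      have := h (σ.symm j)
      simp_all [Finset.mem_map_equiv]
    exact Finset.prod_eq_zero (Finset.mem_univ i) (if_neg hi)
  · simp

/-- The determinant `det(t_a^b)`, with exponents starting at `1`. -/
lemma det_pow_succ {R : Type*} [CommRing R] {m : ℕ} (t : Fin m → R) :
    (Matrix.of fun a b : Fin m => t a ^ (b.1 + 1)).det =
      (∏ a, t a) * ∏ a, ∏ b ∈ Finset.Ioi a, (t b - t a) := by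
  rw [← Matrix.det_vandermonde, ← Matrix.det_mul_column]
  simp [Matrix.vandermonde, pow_succ']

/-- The variables `x` followed by the variables `y`. -/
def joinVars {F : Type*} {n k : ℕ} (hk : k ≤ n) (x : Fin k → F) (y : Fin (n - k) → F) :
    Fin n → F :=
  Sum.elim x y ∘ (blockEquiv hk).symm

lemma sum_V_mul_V_compl {F : Type*} [Field F] {n k : ℕ} (hk : k ≤ n) (x : Fin k → F)
    (y : Fin (n - k) → F) :
    ∑ I : {s : Finset (Fin n) // s.card = k},
      (-1) ^ ell I.1 I.2 * V I.1 I.2 x * V I.1ᶜ (card_compl_of_card_eq I.2) y =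
      (Matrix.of fun a b : Fin n => joinVars hk x y a ^ (b.1 + 1)).det /
        ((Matrix.of fun a b : Fin k => x a ^ (b.1 + 1)).det *
          (Matrix.of fun a b : Fin (n - k) => y a ^ (b.1 + 1)).det) := by
  rw [det_eq_sum_minors hk, Finset.sum_div]
  refine Finset.sum_congr rfl fun I _ => ?_
  simp only [V, joinVars, Matrix.of_apply, Function.comp_apply, Equiv.symm_apply_apply,
    Sum.elim_inl, Sum.elim_inr]
  rw [mul_assoc, div_mul_div_comm, mul_assoc, ← mul_div_assoc]

lemma det_joinVars {F : Type*} [Field F] {n k : ℕ} (hk : k ≤ n) (x : Fin k → F)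
    (y : Fin (n - k) → F) :
    (Matrix.of fun a b : Fin n => joinVars hk x y a ^ (b.1 + 1)).det =
      (Matrix.of fun a b : Fin k => x a ^ (b.1 + 1)).det *
        (Matrix.of fun a b : Fin (n - k) => y a ^ (b.1 + 1)).det * Rfun x y := by
  simp only [det_pow_succ]
  rw [prod_prod_Ioi_blockEquiv hk, ← (blockEquiv hk).prod_comp, Fintype.prod_sum_type]
  simp only [joinVars, Function.comp_apply, Equiv.symm_apply_apply, Sum.elim_inl, Sum.elim_inr,
    Rfun]
  ring

lemma det_pow_succ_ne_zero {F : Type*} [Field F] {m : ℕ} {t : Fin m → F}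
    (ht : Function.Injective t) (h0 : ∀ a, t a ≠ 0) :
    (Matrix.of fun a b : Fin m => t a ^ (b.1 + 1)).det ≠ 0 := by
  rw [det_pow_succ, ← Matrix.det_vandermonde]
  exact mul_ne_zero (Finset.prod_ne_zero_iff.2 fun a _ => h0 a)
    (Matrix.det_vandermonde_ne_zero_iff.2 ht)

/-- For nonzero variables, distinct within each group, the alternating sum of products of
complementary Schur-type functions is the resultant. -/
lemma sum_V_mul_V_compl_eq_Rfun {F : Type*} [Field F] {n k : ℕ} (hk : k ≤ n) {x : Fin k → F}
    {y : Fin (n - k) → F} (hx : Function.Injective x) (hx0 : ∀ a, x a ≠ 0)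
    (hy : Function.Injective y) (hy0 : ∀ b, y b ≠ 0) :
    ∑ I : {s : Finset (Fin n) // s.card = k},
      (-1) ^ ell I.1 I.2 * V I.1 I.2 x * V I.1ᶜ (card_compl_of_card_eq I.2) y = Rfun x y := by
  rw [sum_V_mul_V_compl hk, det_joinVars hk, mul_div_cancel_left₀]
  exact mul_ne_zero (det_pow_succ_ne_zero hx hx0) (det_pow_succ_ne_zero hy hy0)

lemma Xv_injective (n : ℕ) : Function.Injective (Xv n) :=
  (IsFractionRing.injective _ _).comp (X_injective)

lemma Xv_ne_zero (n : ℕ) (a : Fin n) : Xv n a ≠ 0 := by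
  rw [Xv, Ne, IsFractionRing.to_map_eq_zero_iff]
  exact X_ne_zero a

/-- The set of the first `k` elements of `{1, …, n}`. -/
def initialSubset (n k : ℕ) : Finset (Fin n) :=
  Finset.univ.filter fun i => i.1 < k

lemma mem_initialSubset {n k : ℕ} {i : Fin n} : i ∈ initialSubset n k ↔ i.1 < k := by
  simp [initialSubset]

lemma card_initialSubset {n k : ℕ} (hk : k ≤ n) : (initialSubset n k).card = k := by
  rw [initialSubset, Fin.card_filter_val_lt, min_eq_right hk]

lemma enum_initialSubset {n k : ℕ} (hk : k ≤ n) (a : Fin k) :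
    enum (initialSubset n k) (card_initialSubset hk) a = blockEquiv hk (.inl a) := by
  have := Finset.orderEmbOfFin_unique (card_initialSubset hk)
    (f := fun a => blockEquiv hk (.inl a)) (fun a => mem_initialSubset.2 a.2) (fun _ _ h => h)
  exact (congrFun this a).symm

lemma enum_initialSubset_compl {n k : ℕ} (hk : k ≤ n) (b : Fin (n - k)) :
    enum (initialSubset n k)ᶜ (card_compl_of_card_eq (card_initialSubset hk)) b =
      blockEquiv hk (.inr b) := by
  have := Finset.orderEmbOfFin_unique (card_compl_of_card_eq (card_initialSubset hk))
    (f := fun b => blockEquiv hk (.inr b))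
    (fun b => by simp [mem_initialSubset, val_blockEquiv_inr])
    (fun _ _ h => Nat.add_lt_add_left h k)
  exact (congrFun this b).symm

lemma permOfSubset_initialSubset {n k : ℕ} (hk : k ≤ n) :
    permOfSubset hk (initialSubset n k) (card_initialSubset hk) = Equiv.refl _ := by
  ext i
  obtain ⟨a | b, rfl⟩ := (blockEquiv hk).surjective i
  · rw [permOfSubset_blockEquiv_inl, enum_initialSubset, Equiv.refl_apply]
  · rw [permOfSubset_blockEquiv_inr, enum_initialSubset_compl, Equiv.refl_apply]

/-- A subset of cardinality `k` other than `{1, …, k}` misses some element of `{1, …, k}`. -/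
lemma exists_enum_compl_eq_inl {n k : ℕ} (hk : k ≤ n) {J : Finset (Fin n)} (hJ : J.card = k)
    (hne : J ≠ initialSubset n k) :
    ∃ a b, enum Jᶜ (card_compl_of_card_eq hJ) b = blockEquiv hk (.inl a) := by
  obtain ⟨i, hi, hiJ⟩ : ∃ i ∈ initialSubset n k, i ∉ J := by
    by_contra! h
    exact hne (Finset.eq_of_subset_of_card_le h (by rw [hJ, card_initialSubset hk])).symm
  obtain ⟨b, hb⟩ := exists_enum_eq (card_compl_of_card_eq hJ) (Finset.mem_compl.2 hiJ)
  exact ⟨⟨i.1, mem_initialSubset.1 hi⟩, b, hb⟩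

/-- `R(x₁,…,x_k; x_{J̄})` vanishes for every `k`-element `J` other than `{1, …, k}`. -/
lemma Rfun_enum_compl_eq_zero {n k : ℕ} (hk : k ≤ n) {J : Finset (Fin n)} (hJ : J.card = k)
    (hne : J ≠ initialSubset n k) :
    Rfun (fun a : Fin k => Xv n (blockEquiv hk (.inl a)))
      (fun b => Xv n (enum Jᶜ (card_compl_of_card_eq hJ) b)) = 0 := by
  obtain ⟨a, b, hab⟩ := exists_enum_compl_eq_inl hk hJ hne
  exact Finset.prod_eq_zero (Finset.mem_univ a)
    (Finset.prod_eq_zero (Finset.mem_univ b) (sub_eq_zero.2 (congrArg (Xv n) hab)))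

lemma Rfun_ne_zero {n k : ℕ} (hk : k ≤ n) :
    Rfun (fun a : Fin k => Xv n (blockEquiv hk (.inl a)))
      (fun b => Xv n (blockEquiv hk (.inr b))) ≠ 0 := by
  refine Finset.prod_ne_zero_iff.2 fun a _ => Finset.prod_ne_zero_iff.2 fun b _ => ?_
  rw [sub_ne_zero, (Xv_injective n).ne_iff, (blockEquiv hk).injective.ne_iff]
  exact Sum.inr_ne_inl

/-- Corollary A.3: for a Laurent polynomial `f = g / (x₁⋯x_n)^m` which is
symmetric separately in its first `k` and last `n − k` arguments,
`f = Σ_I (−1)^{ℓ(I)} V_I(x₁,…,x_k) Σ_J f(x_J, x_{J̄}) V_{Ī}(x_{J̄}) / R(x_J; x_{J̄})`. -/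
theorem laurent_expansion_in_schur (n k : ℕ) (hk : k ≤ n)
    (g : MvPolynomial (Fin n) ℂ) (m : ℕ)
    (hsym : ∀ σ : Equiv.Perm (Fin n),
      (∀ a : Fin n, a.1 < k ↔ (σ a).1 < k) → rename σ g = g) :
    algebraMap (MvPolynomial (Fin n) ℂ) (RF n) g / (∏ i : Fin n, Xv n i) ^ m
      = ∑ I : {s : Finset (Fin n) // s.card = k},
          (-1 : RF n) ^ ell I.1 I.2 *
            V I.1 I.2 (fun a : Fin k => Xv n ⟨a.1, lt_of_lt_of_le a.2 hk⟩) *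
            ∑ J : {s : Finset (Fin n) // s.card = k},
              (algebraMap (MvPolynomial (Fin n) ℂ) (RF n)
                  (rename (permOfSubset hk J.1 J.2) g) /
                (∏ i : Fin n, Xv n i) ^ m) *
              V (m := n - k) (I.1ᶜ) (by simp [Finset.card_compl, I.2])
                (fun b => Xv n (enum (m := n - k) (J.1ᶜ)
                  (by simp [Finset.card_compl, J.2]) b)) /
              Rfun (fun a => Xv n (enum J.1 J.2 a))
                (fun b => Xv n (enum (m := n - k) (J.1ᶜ)
                  (by simp [Finset.card_compl, J.2]) b)) := by
  simp_rw [← blockEquiv_inl hk, Finset.mul_sum]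
  rw [Finset.sum_comm]
  have key (J : {s : Finset (Fin n) // s.card = k}) :=
    sum_V_mul_V_compl_eq_Rfun hk
      (x := fun a : Fin k => Xv n (blockEquiv hk (.inl a)))
      (y := fun b => Xv n (enum J.1ᶜ (card_compl_of_card_eq J.2) b))
      ((Xv_injective n).comp ((blockEquiv hk).injective.comp Sum.inl_injective))
      (fun _ => Xv_ne_zero n _)
      ((Xv_injective n).comp (enum_strictMono _ _).injective) (fun _ => Xv_ne_zero n _)
  have inner (J : {s : Finset (Fin n) // s.card = k}) (c r : RF n) :
      ∑ I : {s : Finset (Fin n) // s.card = k},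
        (-1 : RF n) ^ ell I.1 I.2 *
          V I.1 I.2 (fun a : Fin k => Xv n (blockEquiv hk (.inl a))) *
          (c * V I.1ᶜ (card_compl_of_card_eq I.2)
            (fun b => Xv n (enum J.1ᶜ (card_compl_of_card_eq J.2) b)) / r) =
      c * Rfun (fun a : Fin k => Xv n (blockEquiv hk (.inl a)))
        (fun b => Xv n (enum J.1ᶜ (card_compl_of_card_eq J.2) b)) / r := by
    rw [← key J, Finset.mul_sum, Finset.sum_div]
    exact Finset.sum_congr rfl fun I _ => by ring
  rw [Finset.sum_congr rfl fun J _ => inner J _ _,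
    Finset.sum_eq_single ⟨initialSubset n k, card_initialSubset hk⟩]
  · simp only [enum_initialSubset hk, enum_initialSubset_compl hk, permOfSubset_initialSubset]
    rw [mul_div_cancel_right₀ _ (Rfun_ne_zero hk), Equiv.coe_refl, rename_id_apply]
  · rintro ⟨J, hJ⟩ - hne
    rw [Rfun_enum_compl_eq_zero hk hJ fun h => hne (Subtype.ext h), mul_zero, zero_div]
  · simp

end
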